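/- Let P^σ_k be the convex cone of k-positive normal completely bounded maps on B(K), and A_k the set of all ω_{x,x} ∈ T(H) with rank x ≤ k. Then the set C_{P^σ_k} = {C_φ : φ ∈ P^σ_k} is weak*-dense in the dual cone A_k^∘ = {X ∈ B(H) : ⟨X, ρ⟩ ≥ 0 for all ρ ∈ A_k}. -/

import Mathlib

set_option synthInstance.maxHeartbeats 1000000
set_option maxHeartbeats 1000000

noncomputable section

open scoped InnerProductSpace ComplexOrder
open ContinuousLinearMap

local notation "⟪" x ", " y "⟫" => @inner ℂ _ _ x y

namespace ChoiInf

variable {H : Type*} [NormedAddCommGroup H] [InnerProductSpace ℂ H] [CompleteSpace H]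

/-- The rank one operator `x ⊠ y : z ↦ (z|y)·x = ⟪y, z⟫ • x`
(inner products written with Mathlib's convention: conjugate linear in the
first variable, so that the paper's `(z|y)` is `⟪y, z⟫`). -/
def rankOne (x y : H) : H →L[ℂ] H := (innerSL ℂ y).smulRight x

/-- The trace of an operator, computed relative to a Hilbert basis:
`Tr X = Σᵢ (X eᵢ | eᵢ) = Σᵢ ⟪eᵢ, X eᵢ⟫`.  (For trace class operators this does
not depend on the choice of basis.) -/
def tr {ι : Type*} (b : HilbertBasis ι ℂ H) (T : H →L[ℂ] H) : ℂ :=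
  ∑' i, ⟪b i, T (b i)⟫

/-- The bilinear pairing `⟨A, B⟩ = Tr (A B)` between `B(H)` and `T(H)`. -/
def pairing {ι : Type*} (b : HilbertBasis ι ℂ H) (A T : H →L[ℂ] H) : ℂ :=
  tr b (A ∘L T)

/-- Trace class operators, characterized by nuclear representations
`T = Σₙ xₙ ⊠ yₙ` with `Σₙ ‖xₙ‖‖yₙ‖ < ∞`. -/
def IsTraceClass (T : H →L[ℂ] H) : Prop :=
  ∃ x y : ℕ → H, Summable (fun n => ‖x n‖ * ‖y n‖) ∧
    ∀ z, T z = ∑' n, ⟪y n, z⟫ • x n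

/-- The trace norm, as the infimum of `Σₙ ‖xₙ‖‖yₙ‖` over all nuclear
representations `T = Σₙ xₙ ⊠ yₙ`. -/
def traceNorm (T : H →L[ℂ] H) : ℝ :=
  sInf {c : ℝ | ∃ x y : ℕ → H, HasSum (fun n => ‖x n‖ * ‖y n‖) c ∧
    ∀ z, T z = ∑' n, ⟪y n, z⟫ • x n}

/-- `(Φ, Φst)` is a dual pair:  `Φst` preserves the trace class and
`⟨Φ A, T⟩ = ⟨A, Φst T⟩` for all trace class `T`.  A linear map `Φ` on `B(H)` is
normal (σ-weakly continuous) precisely when it admits such a predual map `Φst`. -/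
def IsNormalPair {ι : Type*} (b : HilbertBasis ι ℂ H)
    (Φ Φst : (H →L[ℂ] H) →ₗ[ℂ] (H →L[ℂ] H)) : Prop :=
  (∀ T, IsTraceClass T → IsTraceClass (Φst T)) ∧
    ∀ A T, IsTraceClass T → pairing b (Φ A) T = pairing b A (Φst T)

/-- Positivity of a `k × k` matrix of operators, i.e. positivity of the
corresponding operator on `H ⊕ ⋯ ⊕ H`. -/
def MatPos {k : ℕ} (A : Fin k → Fin k → (H →L[ℂ] H)) : Prop :=
  ∀ v : Fin k → H, 0 ≤ ∑ i, ∑ j, ⟪v i, A i j (v j)⟫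

/-- The operator on `H ⊕ ⋯ ⊕ H` given by a `k × k` matrix of operators has norm `≤ c`. -/
def matNormLe {k : ℕ} (A : Fin k → Fin k → (H →L[ℂ] H)) (c : ℝ) : Prop :=
  ∀ v w : Fin k → H,
    ‖∑ i, ∑ j, ⟪w i, A i j (v j)⟫‖ ≤
      c * Real.sqrt (∑ i, ‖v i‖ ^ 2) * Real.sqrt (∑ i, ‖w i‖ ^ 2)

/-- A von Neumann algebra is a factor when its center consists of the scalars. -/
def IsFactor (M : VonNeumannAlgebra H) : Prop :=
  ∀ T ∈ M, T ∈ M.commutant → ∃ c : ℂ, T = c • (1 : H →L[ℂ] H)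

/-- `x0` is a cyclic vector for `M`. -/
def Cyclic (M : VonNeumannAlgebra H) (x0 : H) : Prop :=
  Dense {y : H | ∃ A ∈ M, A x0 = y}

/-- `x0` is a separating vector for `M`. -/
def Separating (M : VonNeumannAlgebra H) (x0 : H) : Prop :=
  ∀ A ∈ M, A x0 = 0 → A = 0

/-- `Φ` restricts on `alg(M', M)` to the map `φ̃ : A'B ↦ A'·φ(B)`.
(Maps `φ : M → M` are encoded as linear maps on `B(H)` sending `M` into `M`;
only the restriction to `M` is relevant.) -/
def ExtendsTilde (M : VonNeumannAlgebra H)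
    (φ Φ : (H →L[ℂ] H) →ₗ[ℂ] (H →L[ℂ] H)) : Prop :=
  ∀ A' ∈ M.commutant, ∀ B ∈ M, Φ (A' * B) = A' * φ B

/-- The space `CB^σ_ε(M)` of maps `φ : M → M` such that `φ̃` extends to a normal
map on `B(H)`. -/
def CBSigmaE {ι : Type*} (b : HilbertBasis ι ℂ H) (M : VonNeumannAlgebra H) :
    Set ((H →L[ℂ] H) →ₗ[ℂ] (H →L[ℂ] H)) :=
  {φ | (∀ B ∈ M, φ B ∈ M) ∧
    ∃ Φ Φst, ExtendsTilde M φ Φ ∧ IsNormalPair b Φ Φst}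

/-- `φ` is completely positive as a map on `M`. -/
def IsCPOn (M : VonNeumannAlgebra H) (φ : (H →L[ℂ] H) →ₗ[ℂ] (H →L[ℂ] H)) : Prop :=
  ∀ (k : ℕ) (A : Fin k → Fin k → (H →L[ℂ] H)), (∀ i j, A i j ∈ M) →
    MatPos A → MatPos fun i j => φ (A i j)

/-- `φ` is completely positive (on all of `B(H)`). -/
def IsCPFull (φ : (H →L[ℂ] H) →ₗ[ℂ] (H →L[ℂ] H)) : Prop :=
  ∀ (k : ℕ) (A : Fin k → Fin k → (H →L[ℂ] H)), MatPos A → MatPos fun i j => φ (A i j)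

/-- `c` is a completely bounded bound for `φ` as a map on `M`. -/
def CBBoundOn (M : VonNeumannAlgebra H) (φ : (H →L[ℂ] H) →ₗ[ℂ] (H →L[ℂ] H))
    (c : ℝ) : Prop :=
  ∀ (k : ℕ) (A : Fin k → Fin k → (H →L[ℂ] H)), (∀ i j, A i j ∈ M) →
    matNormLe A 1 → matNormLe (fun i j => φ (A i j)) c

/-- The completely bounded norm of `φ` as a map on `M`. -/
def cbNormOn (M : VonNeumannAlgebra H) (φ : (H →L[ℂ] H) →ₗ[ℂ] (H →L[ℂ] H)) : ℝ :=
  sInf {c : ℝ | 0 ≤ c ∧ CBBoundOn M φ c}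

/-- `φ` is completely bounded as a map on `M`. -/
def IsCBOn (M : VonNeumannAlgebra H) (φ : (H →L[ℂ] H) →ₗ[ℂ] (H →L[ℂ] H)) : Prop :=
  ∃ c, 0 ≤ c ∧ CBBoundOn M φ c

/-- `φ` is normal as a map on `M`: every normal functional composed with `φ`
is again normal (i.e. implemented by a trace class operator). -/
def NormalOn {ι : Type*} (b : HilbertBasis ι ℂ H) (M : VonNeumannAlgebra H)
    (φ : (H →L[ℂ] H) →ₗ[ℂ] (H →L[ℂ] H)) : Prop :=
  ∀ T, IsTraceClass T → ∃ T', IsTraceClass T' ∧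
    ∀ A ∈ M, pairing b (φ A) T = pairing b A T'

/-- The map `Ad_V : X ↦ V* X V`. -/
def AdL (V : H →L[ℂ] H) : (H →L[ℂ] H) →ₗ[ℂ] (H →L[ℂ] H) where
  toFun X := star V * X * V
  map_add' X Y := by simp [add_mul, mul_add]
  map_smul' c X := by simp [smul_mul_assoc, mul_smul_comm]

/-- `p` is a minimal (nonzero) projection in `M`. -/
def IsMinimalProjection (M : VonNeumannAlgebra H) (p : H →L[ℂ] H) : Prop :=
  p ∈ M ∧ IsIdempotentElem p ∧ IsSelfAdjoint p ∧ p ≠ 0 ∧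
    ∀ q, q ∈ M → IsIdempotentElem q → IsSelfAdjoint q → q ≠ 0 →
      q * p = q → p * q = q → q = p

/-- A factor is of type I precisely when it contains a minimal projection. -/
def IsTypeI (M : VonNeumannAlgebra H) : Prop :=
  ∃ p, IsMinimalProjection M p




variable {K : Type*} [NormedAddCommGroup K] [InnerProductSpace ℂ K] [CompleteSpace K]

/-- `T` is a Hilbert–Schmidt operator (relative to a Hilbert basis `e`;
this does not depend on the choice of `e`). -/
def IsHS {ι : Type*} (e : HilbertBasis ι ℂ K) (T : K →L[ℂ] K) : Prop :=
  Summable fun i => ‖T (e i)‖ ^ 2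

/-- A model of the Hilbert space `HS(K)` of Hilbert–Schmidt operators on `K`,
with `B(K)` acting by left multiplications `Lmul` and right multiplications
`Rmul`.  `toOp` regards a vector of `H` as an operator on `K`; its range is
exactly the set of Hilbert–Schmidt operators, and the inner product of `H` is
`(x|y) = Tr (x y*)`, i.e. `⟪x, y⟫ = Σᵢ ⟪x eᵢ, y eᵢ⟫`. -/
structure HSModel {ι : Type*} (e : HilbertBasis ι ℂ K) (H : Type*)
    [NormedAddCommGroup H] [InnerProductSpace ℂ H] [CompleteSpace H] where
  toOp : H →ₗ[ℂ] (K →L[ℂ] K)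
  inj : Function.Injective toOp
  mem_range : ∀ T : K →L[ℂ] K, IsHS e T ↔ ∃ x : H, toOp x = T
  inner_eq : ∀ x y : H, ⟪x, y⟫ = ∑' i, ⟪toOp x (e i), toOp y (e i)⟫
  Lmul : (K →L[ℂ] K) → (H →L[ℂ] H)
  Lmul_eq : ∀ a x, toOp (Lmul a x) = a ∘L toOp x
  Rmul : (K →L[ℂ] K) → (H →L[ℂ] H)
  Rmul_eq : ∀ a x, toOp (Rmul a x) = toOp x ∘L a

/-- The operator `T` has rank at most `k`. -/
def rankLE (T : K →L[ℂ] K) (k : ℕ) : Prop :=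
  Module.rank ℂ (LinearMap.range (T : K →ₗ[ℂ] K)) ≤ (k : Cardinal)

variable {H : Type*} [NormedAddCommGroup H] [InnerProductSpace ℂ H] [CompleteSpace H]
  {ι : Type*} {e : HilbertBasis ι ℂ K}

/-- `Φ` restricts to the map `φ̃ : R_y L_x ↦ R_y L_{φ(x)}` on `alg(M', M)` for
`M = L_{B(K)}`. -/
def HSExt (m : HSModel e H) (φ : (K →L[ℂ] K) →ₗ[ℂ] (K →L[ℂ] K))
    (Φ : (H →L[ℂ] H) →ₗ[ℂ] (H →L[ℂ] H)) : Prop :=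
  ∀ a x : K →L[ℂ] K, Φ (m.Rmul a ∘L m.Lmul x) = m.Rmul a ∘L m.Lmul (φ x)

/-- `φ` is `k`-positive. -/
def kPos (k : ℕ) (φ : (K →L[ℂ] K) →ₗ[ℂ] (K →L[ℂ] K)) : Prop :=
  ∀ A : Fin k → Fin k → (K →L[ℂ] K), MatPos A → MatPos fun i j => φ (A i j)

/-- `φ` is completely bounded (as a map on all of `B(K)`). -/
def IsCBFullK (φ : (K →L[ℂ] K) →ₗ[ℂ] (K →L[ℂ] K)) : Prop :=
  ∃ c, 0 ≤ c ∧ ∀ (k : ℕ) (A : Fin k → Fin k → (K →L[ℂ] K)),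
    matNormLe A 1 → matNormLe (fun i j => φ (A i j)) c

/-- `φ` belongs to `CB^σ(B(K))`: it is normal and completely bounded. -/
def NormalCB (e : HilbertBasis ι ℂ K) (φ : (K →L[ℂ] K) →ₗ[ℂ] (K →L[ℂ] K)) : Prop :=
  (∃ φst, IsNormalPair e φ φst) ∧ IsCBFullK φ

/-- The cone `𝒮_k` of `T(H)`: the trace-norm closed convex cone generated by
the `ω_{x,x} = x ⊠ x` with `rank x ≤ k` (rank as an operator on `K`). -/
def SchmidtCone (m : HSModel e H) (k : ℕ) : Set (H →L[ℂ] H) :=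
  {T | ∀ ε : ℝ, 0 < ε → ∃ (n : ℕ) (x : Fin n → H),
    (∀ i, rankLE (m.toOp (x i)) k) ∧
      traceNorm (T - ∑ i, rankOne (x i) (x i)) < ε}

/-- `ψ` belongs to the convex cone `𝔼_k` generated by the maps `Ad_V` with
`rank V ≤ k`. -/
def InEk (k : ℕ) (ψ : (K →L[ℂ] K) →ₗ[ℂ] (K →L[ℂ] K)) : Prop :=
  ∃ (n : ℕ) (V : Fin n → (K →L[ℂ] K)), (∀ i, rankLE (V i) k) ∧
    ∀ x, ψ x = ∑ i, star (V i) * x * V i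

/-- `φ` (with Choi trace-class operator `Dphi = D_φ`) is `k`-superpositive:
it lies in the `‖·‖_D`-closure of the cone `𝔼_k`, where `‖ψ‖_D = ‖D_ψ‖_{T(H)}`. -/
def kSuper {ιH : Type*} (bH : HilbertBasis ιH ℂ H) (m : HSModel e H) (x0 : H)
    (k : ℕ) (Dphi : H →L[ℂ] H) : Prop :=
  ∀ ε : ℝ, 0 < ε → ∃ ψ Ψ Ψst, InEk k ψ ∧ HSExt m ψ Ψ ∧ IsNormalPair bH Ψ Ψst ∧
    traceNorm (Dphi - Ψst (rankOne x0 x0)) < ε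


theorem rankOne_apply (x y z : H) : rankOne x y z = ⟪y, z⟫ • x := rfl

theorem inner_rankOne (x y u v : H) : ⟪u, rankOne x y v⟫ = ⟪rankOne y x u, v⟫ := by
  simp only [rankOne_apply, inner_smul_right, inner_smul_left, inner_conj_symm]
  ring

/-! ### Trace class operators -/

section TraceClass

theorem summable_smul_of_nuclear {x y : ℕ → H} (h : Summable fun n => ‖x n‖ * ‖y n‖) (z : H) :
    Summable fun n => ⟪y n, z⟫ • x n := by
  refine .of_norm_bounded (h.mul_right ‖z‖) fun n => ?_
  rw [norm_smul]
  calc ‖⟪y n, z⟫‖ * ‖x n‖ ≤ (‖y n‖ * ‖z‖) * ‖x n‖ := by gcongr; exact norm_inner_le_norm _ _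
    _ = ‖x n‖ * ‖y n‖ * ‖z‖ := by ring

theorem IsTraceClass.zero : IsTraceClass (0 : H →L[ℂ] H) :=
  ⟨0, 0, by simp, by simp⟩

theorem IsTraceClass.add {S T : H →L[ℂ] H} (hS : IsTraceClass S) (hT : IsTraceClass T) :
    IsTraceClass (S + T) := by
  obtain ⟨x, y, h, hxy⟩ := hS
  obtain ⟨x', y', h', hxy'⟩ := hT
  let σ : ℕ ⊕ ℕ ≃ ℕ := Equiv.natSumNatEquivNat
  have hs : Summable fun s : ℕ ⊕ ℕ => ‖Sum.elim x x' s‖ * ‖Sum.elim y y' s‖ :=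
    (HasSum.sum h.hasSum h'.hasSum).summable
  refine ⟨Sum.elim x x' ∘ σ.symm, Sum.elim y y' ∘ σ.symm,
    (σ.symm.summable_iff (f := fun s => ‖Sum.elim x x' s‖ * ‖Sum.elim y y' s‖)).2 hs, fun z => ?_⟩
  have hz : HasSum (fun s : ℕ ⊕ ℕ => ⟪Sum.elim y y' s, z⟫ • Sum.elim x x' s)
      (S z + T z) := by
    rw [hxy, hxy']
    exact HasSum.sum (summable_smul_of_nuclear h z).hasSum
      (summable_smul_of_nuclear h' z).hasSum
  exact ((σ.symm.hasSum_iff.2 hz).tsum_eq).symm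

theorem IsTraceClass.sum {S : Type*} (s : Finset S) {T : S → H →L[ℂ] H}
    (h : ∀ i ∈ s, IsTraceClass (T i)) : IsTraceClass (∑ i ∈ s, T i) :=
  Finset.sum_induction _ IsTraceClass (fun _ _ => IsTraceClass.add) IsTraceClass.zero h

theorem nuclear_comp {T : H →L[ℂ] H} {x y : ℕ → H} (h : Summable fun n => ‖x n‖ * ‖y n‖)
    (hT : ∀ z, T z = ∑' n, ⟪y n, z⟫ • x n) (A B : H →L[ℂ] H) :
    (Summable fun n => ‖A (x n)‖ * ‖adjoint B (y n)‖) ∧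
      ∀ z, (A ∘L T ∘L B) z = ∑' n, ⟪adjoint B (y n), z⟫ • A (x n) := by
  constructor
  · refine .of_nonneg_of_le (fun n => by positivity) (fun n => ?_)
      (h.mul_left (‖A‖ * ‖adjoint B‖))
    calc ‖A (x n)‖ * ‖adjoint B (y n)‖ ≤ (‖A‖ * ‖x n‖) * (‖adjoint B‖ * ‖y n‖) := by
          gcongr <;> exact le_opNorm _ _
      _ = _ := by ring
  · intro z
    simp only [coe_comp, Function.comp_apply, hT, adjoint_inner_left]
    rw [A.map_tsum (summable_smul_of_nuclear h _)]
    simp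

theorem IsTraceClass.comp {T : H →L[ℂ] H} (hT : IsTraceClass T) (A B : H →L[ℂ] H) :
    IsTraceClass (A ∘L T ∘L B) := by
  obtain ⟨x, y, h, hxy⟩ := hT
  exact ⟨_, _, nuclear_comp h hxy A B⟩

theorem summable_mul_and_tsum_mul_le {f g : ι → ℝ} (hf : ∀ i, 0 ≤ f i) (hg : ∀ i, 0 ≤ g i)
    (hf2 : Summable fun i => f i ^ 2) (hg2 : Summable fun i => g i ^ 2) :
    (Summable fun i => f i * g i) ∧
      ∑' i, f i * g i ≤ √(∑' i, f i ^ 2) * √(∑' i, g i ^ 2) := by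
  simp only [← Real.rpow_two] at hf2 hg2 ⊢
  simpa only [Real.sqrt_eq_rpow] using
    Real.summable_and_inner_le_Lp_mul_Lq_tsum_of_nonneg Real.HolderConjugate.two_two hf hg hf2 hg2

theorem summable_norm_inner_mul_inner (b : HilbertBasis ι ℂ H) (u v : H) :
    (Summable fun i => ‖⟪u, b i⟫ * ⟪b i, v⟫‖) ∧ ∑' i, ‖⟪u, b i⟫ * ⟪b i, v⟫‖ ≤ ‖u‖ * ‖v‖ := by
  have h := summable_mul_and_tsum_mul_le (fun i => norm_nonneg ⟪b i, u⟫)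
    (fun i => norm_nonneg ⟪b i, v⟫) (b.orthonormal.inner_products_summable u)
    (b.orthonormal.inner_products_summable v)
  simp only [norm_mul, norm_inner_symm u]
  refine ⟨h.1, h.2.trans ?_⟩
  gcongr <;> exact Real.sqrt_le_iff.2 ⟨norm_nonneg _, b.orthonormal.tsum_inner_products_le _⟩

theorem hasSum_trace_of_nuclear (b : HilbertBasis ι ℂ H) {T : H →L[ℂ] H} {x y : ℕ → H}
    (h : Summable fun n => ‖x n‖ * ‖y n‖) (hT : ∀ z, T z = ∑' n, ⟪y n, z⟫ • x n)
    (A : H →L[ℂ] H) : HasSum (fun i => ⟪b i, (A ∘L T) (b i)⟫) (∑' n, ⟪y n, A (x n)⟫) := by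
  have hsum : Summable fun p : ℕ × ι => ⟪y p.1, b p.2⟫ * ⟪b p.2, A (x p.1)⟫ := by
    have hnonneg : 0 ≤ fun p : ℕ × ι => ‖⟪y p.1, b p.2⟫ * ⟪b p.2, A (x p.1)⟫‖ :=
      fun p => norm_nonneg _
    refine .of_norm ((summable_prod_of_nonneg hnonneg).2
      ⟨fun n => (summable_norm_inner_mul_inner b (y n) (A (x n))).1, ?_⟩)
    refine .of_nonneg_of_le (fun n => tsum_nonneg fun _ => norm_nonneg _)
      (fun n => (summable_norm_inner_mul_inner b (y n) (A (x n))).2) ?_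
    refine .of_nonneg_of_le (fun n => by positivity) (fun n => ?_) (h.mul_left ‖A‖)
    calc ‖y n‖ * ‖A (x n)‖ ≤ ‖y n‖ * (‖A‖ * ‖x n‖) := by gcongr; exact le_opNorm _ _
      _ = _ := by ring
  have hdiag : (fun i => ⟪b i, (A ∘L T) (b i)⟫) =
      fun i => ∑' n, ⟪y n, b i⟫ * ⟪b i, A (x n)⟫ := by
    funext i
    have hs := summable_smul_of_nuclear h (b i)
    rw [ContinuousLinearMap.comp_apply, hT, A.map_tsum hs]
    simpa [inner_smul_right] using (innerSL ℂ (b i)).map_tsum (A.summable hs)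
  have htot : ∑' n, ⟪y n, A (x n)⟫ = ∑' i, ∑' n, ⟪y n, b i⟫ * ⟪b i, A (x n)⟫ := by
    refine Eq.trans ?_ (Summable.tsum_comm (f := fun n i => ⟪y n, b i⟫ * ⟪b i, A (x n)⟫) hsum).symm
    exact tsum_congr fun n => (b.tsum_inner_mul_inner _ _).symm
  rw [hdiag, htot]
  exact hsum.prod_symm.prod.hasSum

theorem pairing_of_nuclear (b : HilbertBasis ι ℂ H) {T : H →L[ℂ] H} {x y : ℕ → H}
    (h : Summable fun n => ‖x n‖ * ‖y n‖) (hT : ∀ z, T z = ∑' n, ⟪y n, z⟫ • x n)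
    (A : H →L[ℂ] H) : pairing b A T = ∑' n, ⟪y n, A (x n)⟫ :=
  (hasSum_trace_of_nuclear b h hT A).tsum_eq

theorem IsTraceClass.summable_trace (b : HilbertBasis ι ℂ H) {T : H →L[ℂ] H}
    (hT : IsTraceClass T) (A : H →L[ℂ] H) : Summable fun i => ⟪b i, (A ∘L T) (b i)⟫ := by
  obtain ⟨x, y, h, hxy⟩ := hT
  exact (hasSum_trace_of_nuclear b h hxy A).summable

theorem pairing_sum_left (b : HilbertBasis ι ℂ H) {S : Type*} [Fintype S] (Z : S → H →L[ℂ] H)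
    {T : H →L[ℂ] H} (hT : IsTraceClass T) :
    pairing b (∑ s, Z s) T = ∑ s, pairing b (Z s) T := by
  simp only [pairing, tr]
  rw [← Summable.tsum_finsetSum fun s _ => hT.summable_trace b (Z s)]
  simp [sum_apply]

theorem pairing_sum_right (b : HilbertBasis ι ℂ H) {S : Type*} [Fintype S] (Z : H →L[ℂ] H)
    {T : S → H →L[ℂ] H} (hT : ∀ s, IsTraceClass (T s)) :
    pairing b Z (∑ s, T s) = ∑ s, pairing b Z (T s) := by
  simp only [pairing, tr]
  rw [← Summable.tsum_finsetSum fun s _ => (hT s).summable_trace b Z]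
  simp [sum_apply]

theorem pairing_comp_comm (b : HilbertBasis ι ℂ H) (A B Z : H →L[ℂ] H) {T : H →L[ℂ] H}
    (hT : IsTraceClass T) : pairing b (A ∘L Z ∘L B) T = pairing b Z (B ∘L T ∘L A) := by
  obtain ⟨x, y, h, hxy⟩ := hT
  obtain ⟨h', hxy'⟩ := nuclear_comp h hxy B A
  rw [pairing_of_nuclear b h hxy, pairing_of_nuclear b h' hxy']
  simp [adjoint_inner_left]

theorem pairing_rankOne (b : HilbertBasis ι ℂ H) (A : H →L[ℂ] H) (x : H) :
    pairing b A (rankOne x x) = ⟪x, A x⟫ := by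
  rw [← b.tsum_inner_mul_inner]
  exact tsum_congr fun i => by simp [rankOne_apply]

end TraceClass

/-! ### Elementary operators -/

section Elementary

variable {S : Type*} [Fintype S]

/-- The elementary operator `Z ↦ Σ_s A_s Z B_s`. -/
def elementary (A B : S → H →L[ℂ] H) : (H →L[ℂ] H) →ₗ[ℂ] (H →L[ℂ] H) where
  toFun Z := ∑ s, A s ∘L Z ∘L B s
  map_add' Y Z := by simp [Finset.sum_add_distrib]
  map_smul' c Z := by simp [Finset.smul_sum]

theorem elementary_apply (A B : S → H →L[ℂ] H) (Z : H →L[ℂ] H) :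
    elementary A B Z = ∑ s, A s ∘L Z ∘L B s := rfl

theorem isNormalPair_elementary (b : HilbertBasis ι ℂ H) (A B : S → H →L[ℂ] H) :
    IsNormalPair b (elementary A B) (elementary B A) := by
  refine ⟨fun T hT => IsTraceClass.sum _ fun s _ => hT.comp _ _, fun Z T hT => ?_⟩
  rw [elementary_apply, elementary_apply, pairing_sum_left b _ hT,
    pairing_sum_right b _ fun s => hT.comp _ _]
  exact Finset.sum_congr rfl fun s _ => pairing_comp_comm b _ _ _ hT

theorem isCBFullK_elementary (A B : S → H →L[ℂ] H) : IsCBFullK (elementary A B) := by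
  refine ⟨∑ s, ‖A s‖ * ‖B s‖, by positivity, fun k Z hZ v w => ?_⟩
  have hnorm : ∀ (C : H →L[ℂ] H) (u : Fin k → H),
      √(∑ i, ‖C (u i)‖ ^ 2) ≤ ‖C‖ * √(∑ i, ‖u i‖ ^ 2) := by
    intro C u
    rw [← Real.sqrt_sq (norm_nonneg C), ← Real.sqrt_mul (sq_nonneg _), Finset.mul_sum]
    gcongr with i
    rw [← mul_pow]
    gcongr
    exact C.le_opNorm _
  have hsplit : ∑ i, ∑ j, ⟪w i, elementary A B (Z i j) (v j)⟫ =
      ∑ s, ∑ i, ∑ j, ⟪adjoint (A s) (w i), Z i j (B s (v j))⟫ := by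
    simp only [elementary_apply, sum_apply, inner_sum, adjoint_inner_left,
      ContinuousLinearMap.comp_apply]
    rw [Finset.sum_comm' (t' := Finset.univ) (s' := fun _ => Finset.univ) (by simp)]
    conv_rhs => rw [Finset.sum_comm]
    rw [Finset.sum_comm]
    exact Finset.sum_congr rfl fun i _ => Finset.sum_comm
  rw [hsplit, Finset.sum_mul, Finset.sum_mul]
  refine (norm_sum_le _ _).trans (Finset.sum_le_sum fun s _ => ?_)
  calc _ ≤ 1 * √(∑ j, ‖B s (v j)‖ ^ 2) * √(∑ i, ‖adjoint (A s) (w i)‖ ^ 2) := hZ _ _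
    _ ≤ 1 * (‖B s‖ * √(∑ j, ‖v j‖ ^ 2)) * (‖adjoint (A s)‖ * √(∑ i, ‖w i‖ ^ 2)) := by
        gcongr <;> exact hnorm _ _
    _ = _ := by rw [LinearIsometryEquiv.norm_map]; ring

end Elementary

/-! ### The Hilbert–Schmidt model -/

theorem isHS_rankOne (e : HilbertBasis ι ℂ K) (u v : K) : IsHS e (rankOne u v) := by
  refine .congr ((e.orthonormal.inner_products_summable v).mul_right (‖u‖ ^ 2)) fun i => ?_
  rw [rankOne_apply, norm_smul, mul_pow, norm_inner_symm]

namespace HSModel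

variable (m : HSModel e H)

/-- The vector of `H` corresponding to the rank one operator `u ⊠ v`. -/
def ketBra (u v : K) : H := ((m.mem_range _).1 (isHS_rankOne e u v)).choose

theorem toOp_ketBra (u v : K) : m.toOp (m.ketBra u v) = rankOne u v :=
  ((m.mem_range _).1 (isHS_rankOne e u v)).choose_spec

theorem inner_ketBra (u v : K) (x : H) : ⟪m.ketBra u v, x⟫ = ⟪u, m.toOp x v⟫ := by
  rw [m.inner_eq, ← adjoint_inner_left, ← e.tsum_inner_mul_inner]
  refine tsum_congr fun i => ?_
  rw [toOp_ketBra, rankOne_apply, inner_smul_left, inner_conj_symm, adjoint_inner_left, mul_comm]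

theorem inner_Lmul {a a' : K →L[ℂ] K} (h : ∀ u v, ⟪a u, v⟫ = ⟪u, a' v⟫) (x y : H) :
    ⟪m.Lmul a x, y⟫ = ⟪x, m.Lmul a' y⟫ := by
  simp only [m.inner_eq, m.Lmul_eq, ContinuousLinearMap.comp_apply, h]

theorem Lmul_rankOne (f g : K) (x : H) :
    m.Lmul (rankOne f g) x = m.ketBra f (adjoint (m.toOp x) g) := by
  apply m.inj
  rw [m.Lmul_eq, toOp_ketBra]
  ext z
  simp [rankOne_apply, adjoint_inner_left]

theorem toOp_injective_of_cyclic {x0 : H}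
    (hcyc : Dense {y : H | ∃ a : K →L[ℂ] K, m.Lmul a x0 = y}) {v : K} (hv : m.toOp x0 v = 0) :
    v = 0 := by
  have h : m.ketBra v v = 0 := by
    refine hcyc.eq_zero_of_inner_left ℂ ?_
    rintro _ ⟨a, rfl⟩
    simp [inner_ketBra, m.Lmul_eq, hv]
  have h' := m.toOp_ketBra v v
  rw [h, map_zero] at h'
  have h'' : ⟪v, v⟫ • v = 0 := by rw [← rankOne_apply, ← h', zero_apply]
  simpa using h''

theorem dense_range_adjoint {T : K →L[ℂ] K} (hT : ∀ v, T v = 0 → v = 0) :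
    DenseRange (adjoint T) := by
  have h : (adjoint T).range.topologicalClosure = ⊤ := by
    rw [Submodule.topologicalClosure_eq_top_iff, orthogonal_range, adjoint_adjoint]
    exact (Submodule.eq_bot_iff _).2 hT
  exact Submodule.dense_iff_topologicalClosure_eq_top.2 h

/-- The span of the rank one operators `u ⊠ v` with `u` and `v` in `U`. -/
def corner (U : Submodule ℂ K) : Submodule ℂ H :=
  Submodule.span ℂ {x | ∃ u ∈ U, ∃ v ∈ U, m.ketBra u v = x}

theorem corner_mono : Monotone m.corner := fun _ _ h =>
  Submodule.span_mono fun _ ⟨u, hu, v, hv, hx⟩ => ⟨u, h hu, v, h hv, hx⟩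

theorem mem_orthogonal_corner {U : Submodule ℂ K} {x : H} :
    x ∈ (m.corner U)ᗮ ↔ ∀ u ∈ U, ∀ v ∈ U, ⟪u, m.toOp x v⟫ = 0 := by
  rw [corner, Submodule.mem_orthogonal]
  constructor
  · intro h u hu v hv
    rw [← inner_ketBra]
    exact h _ (Submodule.subset_span ⟨u, hu, v, hv, rfl⟩)
  · intro h y hy
    induction hy using Submodule.span_induction with
    | mem y hy => obtain ⟨u, hu, v, hv, rfl⟩ := hy; rw [inner_ketBra]; exact h u hu v hv
    | zero => simp
    | add y z _ _ hy hz => simp [inner_add_left, hy, hz]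
    | smul c y _ hy => simp [inner_smul_left, hy]

section Compression

variable {d : Type*} [Fintype d] {U : Submodule ℂ K} (f : OrthonormalBasis d ℂ U)

/-- The compression `x ↦ p x p`, where `p` is the projection onto `U`. -/
def compress (x : H) : H :=
  ∑ α : d × d, ⟪m.ketBra (f α.1 : K) (f α.2), x⟫ • m.ketBra (f α.1 : K) (f α.2)

theorem compress_mem (x : H) : m.compress f x ∈ m.corner U :=
  Submodule.sum_mem _ fun α _ => Submodule.smul_mem _ _
    (Submodule.subset_span ⟨_, (f α.1).2, _, (f α.2).2, rfl⟩)

theorem toOp_compress (x : H) (z : K) : m.toOp (m.compress f x) z =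
    ∑ p, ∑ q, (⟪(f p : K), m.toOp x (f q)⟫ * ⟪(f q : K), z⟫) • (f p : K) := by
  simp [compress, Fintype.sum_prod_type, toOp_ketBra, inner_ketBra, rankOne_apply, smul_smul,
    sum_apply]

theorem sub_compress_mem (x : H) : x - m.compress f x ∈ (m.corner U)ᗮ := by
  rw [mem_orthogonal_corner]
  intro u hu v hv
  have expand : ∀ w ∈ U, ∑ p, ⟪(f p : K), w⟫ • (f p : K) = w := fun w hw => by
    have := congrArg (Subtype.val) (f.sum_repr' ⟨w, hw⟩)
    simpa using this
  have h : ⟪u, m.toOp x v⟫ =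
      ∑ p, ∑ q, ⟪(f p : K), m.toOp x (f q)⟫ * ⟪(f q : K), v⟫ * ⟪u, (f p : K)⟫ := by
    conv_lhs => rw [← expand u hu, ← expand v hv]
    simp only [map_sum, map_smul, sum_inner, inner_sum, inner_smul_left, inner_smul_right,
      inner_conj_symm]
    rw [Finset.sum_comm]
    simp only [Finset.mul_sum]
    exact Finset.sum_congr rfl fun p _ => Finset.sum_congr rfl fun q _ => by ring
  simp [h, toOp_compress]

theorem compress_eq_starProjection [(m.corner U).HasOrthogonalProjection] (x : H) :
    m.compress f x = (m.corner U).starProjection x :=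
  (Submodule.eq_starProjection_of_mem_orthogonal (m.compress_mem f x)
    (m.sub_compress_mem f x)).symm

end Compression

theorem hasOrthogonalProjection_corner (U : Submodule ℂ K) [FiniteDimensional ℂ U] :
    (m.corner U).HasOrthogonalProjection :=
  ⟨fun x => ⟨_, m.compress_mem (stdOrthonormalBasis ℂ U) x,
    m.sub_compress_mem (stdOrthonormalBasis ℂ U) x⟩⟩

theorem topologicalClosure_iSup_corner {G : Type*} [Preorder G] [IsDirectedOrder G]
    {U : G → Submodule ℂ K} (hU : Monotone U) (hdense : Dense {u | ∃ i, u ∈ U i}) :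
    ⊤ ≤ (⨆ i, m.corner (U i)).topologicalClosure := by
  rw [top_le_iff, Submodule.topologicalClosure_eq_top_iff, ← Submodule.iInf_orthogonal,
    Submodule.eq_bot_iff]
  intro x hx
  simp only [Submodule.mem_iInf, mem_orthogonal_corner] at hx
  apply m.inj
  rw [map_zero]
  refine ContinuousLinearMap.ext_on (s := {u | ∃ i, u ∈ U i})
    (hdense.mono Submodule.subset_span) ?_
  rintro v ⟨j, hv⟩
  refine hdense.eq_zero_of_inner_right ℂ ?_
  rintro u ⟨i, hu⟩
  obtain ⟨l, hi, hj⟩ := exists_ge_ge i j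
  exact hx l u (hU hi hu) v (hU hj hv)

end HSModel

theorem hsExt_elementary (m : HSModel e H) {S : Type*} [Fintype S] (A B : S → K →L[ℂ] K) :
    HSExt m (elementary A B) (elementary (fun s => m.Lmul (A s)) fun s => m.Lmul (B s)) := by
  intro a x
  ext z
  apply m.inj
  ext v
  simp [elementary_apply, m.Lmul_eq, m.Rmul_eq, sum_apply]

open Matrix in
open scoped MatrixOrder in
/-- A matrix with nonnegative quadratic form is a Gram matrix. -/
theorem exists_gram {N : Type*} [Fintype N] (M : N → N → ℂ)
    (hM : ∀ x : N → ℂ, 0 ≤ ∑ i, ∑ j, star (x i) * M i j * x j) :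
    ∃ B : N → N → ℂ, ∀ i j, M i j = ∑ r, star (B r i) * B r j := by
  classical
  have hquad : ∀ x : N → ℂ, 0 ≤ star x ⬝ᵥ (Matrix.of M *ᵥ x) := fun x => by
    simpa [dotProduct, mulVec, Finset.mul_sum, mul_assoc] using hM x
  have hpos : (Matrix.of M).PosSemidef := by
    rw [← isPositive_toEuclideanLin_iff, LinearMap.isPositive_iff_complex]
    intro x
    have hx : 0 ≤ ⟪toEuclideanLin (Matrix.of M) x, x⟫ := by
      rw [← inner_conj_symm, ← RCLike.star_def, star_nonneg_iff,
        EuclideanSpace.inner_eq_star_dotProduct, dotProduct_comm]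
      exact hquad _
    obtain ⟨hre, him⟩ := RCLike.nonneg_iff.1 hx
    exact ⟨Complex.ext rfl him.symm, hre⟩
  obtain ⟨B, hB⟩ := CStarAlgebra.nonneg_iff_eq_star_mul_self.mp hpos.nonneg
  exact ⟨B, fun i j => by
    simpa [mul_apply] using congrFun (congrFun hB i) j⟩

/-! ### Maps with prescribed compressed Choi operator -/

section Choi

variable (m : HSModel e H) {d : Type*} [Fintype d] (f g : d → K)

/-- The map on `B(K)` whose Choi operator is the compression of `X` given by `f`, where
`f p = x0* (g p)`. -/
def choiMap (X : H →L[ℂ] H) : (K →L[ℂ] K) →ₗ[ℂ] (K →L[ℂ] K) :=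
  elementary
    (fun s : (d × d) × (d × d) =>
      ⟪m.ketBra (f s.1.1) (f s.1.2), X (m.ketBra (f s.2.1) (f s.2.2))⟫ •
        rankOne (f s.1.1) (g s.1.2))
    (fun s => rankOne (g s.2.2) (f s.2.1))

theorem rankLE_of_factor {k : ℕ} {T : K →L[ℂ] K} (u : Fin k → K) (a : Fin k → K → ℂ)
    (h : ∀ z, T z = ∑ j, a j z • u j) : rankLE T k := by
  have hle : LinearMap.range (T : K →ₗ[ℂ] K) ≤ Submodule.span ℂ (Set.range u) := by
    rintro _ ⟨z, rfl⟩
    rw [coe_coe, h]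
    exact Submodule.sum_mem _ fun j _ => Submodule.smul_mem _ _
      (Submodule.subset_span ⟨j, rfl⟩)
  refine (Submodule.rank_mono hle).trans ((rank_span_le _).trans ?_)
  simpa using Cardinal.mk_range_le_lift (f := u)

theorem kPos_choiMap {X : H →L[ℂ] H} {k : ℕ}
    (hX : ∀ x : H, rankLE (m.toOp x) k → 0 ≤ ⟪x, X x⟫) : kPos k (choiMap m f g X) := by
  intro A hA v
  obtain ⟨B, hB⟩ := exists_gram (fun s t : Fin k × d => ⟪g s.2, A s.1 t.1 (g t.2)⟫) fun x => by
    convert! hA fun i => ∑ q, x (i, q) • g q using 1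
    simp only [Fintype.sum_prod_type, map_sum, map_smul, sum_inner, inner_sum, inner_smul_left,
      inner_smul_right]
    refine Finset.sum_congr rfl fun i _ => ?_
    rw [Finset.sum_comm]
    refine Finset.sum_congr rfl fun j _ => ?_
    rw [Finset.sum_comm]
    simp only [Finset.mul_sum]
    exact Finset.sum_congr rfl fun q _ => Finset.sum_congr rfl fun q' _ => by
      simp only [RCLike.star_def]; ring
  let w : d × d → H := fun α => m.ketBra (f α.1) (f α.2)
  let ξ : Fin k × d → d × d → ℂ := fun r α => ∑ j, ⟪f α.1, v j⟫ * B r (j, α.2)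
  have hrank : ∀ r, rankLE (m.toOp (∑ α, ξ r α • w α)) k := fun r => by
    refine rankLE_of_factor (fun j => ∑ p, ⟪f p, v j⟫ • f p)
      (fun j z => ∑ q, B r (j, q) * ⟪f q, z⟫) fun z => ?_
    simp only [w, ξ, map_sum, map_smul, sum_apply, smul_apply, m.toOp_ketBra, rankOne_apply,
      Fintype.sum_prod_type, Finset.sum_smul, Finset.smul_sum, smul_smul]
    rw [Finset.sum_comm_cycle]
    refine Finset.sum_congr rfl fun j _ => ?_
    refine Finset.sum_congr rfl fun p _ => ?_
    rw [Finset.sum_mul, Finset.sum_smul]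
    refine Finset.sum_congr rfl fun q _ => ?_
    congr 1
    ring
  have hsum : ∑ i, ∑ j, ⟪v i, choiMap m f g X (A i j) (v j)⟫ =
      ∑ r, ⟪∑ α, ξ r α • w α, X (∑ α, ξ r α • w α)⟫ := by
    have hr : ∀ r, ⟪∑ α, ξ r α • w α, X (∑ α, ξ r α • w α)⟫ =
        ∑ s : (d × d) × (d × d), ∑ i, ∑ j, ⟪w s.1, X (w s.2)⟫ *
          (star (⟪f s.1.1, v i⟫ * B r (i, s.1.2)) * (⟪f s.2.1, v j⟫ * B r (j, s.2.2))) := by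
      intro r
      simp only [map_sum, map_smul, sum_inner, inner_sum, inner_smul_left, inner_smul_right]
      simp only [Finset.mul_sum]
      rw [Finset.sum_comm]
      refine Eq.trans ?_ (Fintype.sum_prod_type _).symm
      refine Finset.sum_congr rfl fun α _ => Finset.sum_congr rfl fun β _ => ?_
      simp only [← Finset.mul_sum, ← Finset.sum_mul]
      simp only [ξ, map_sum, RCLike.star_def]
      ring
    simp only [hr]
    rw [Finset.sum_comm (s := Finset.univ (α := Fin k × d))]
    have hl : ∀ i j, ⟪v i, choiMap m f g X (A i j) (v j)⟫ =
        ∑ s : (d × d) × (d × d), ∑ r, ⟪w s.1, X (w s.2)⟫ *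
          (star (⟪f s.1.1, v i⟫ * B r (i, s.1.2)) * (⟪f s.2.1, v j⟫ * B r (j, s.2.2))) := by
      intro i j
      simp only [choiMap, elementary_apply, sum_apply, inner_sum, ContinuousLinearMap.comp_apply,
        smul_apply, rankOne_apply, inner_smul_right, map_smul]
      refine Finset.sum_congr rfl fun s _ => ?_
      rw [hB (i, s.1.2) (j, s.2.2)]
      simp only [Finset.mul_sum, Finset.sum_mul, w]
      refine Finset.sum_congr rfl fun r _ => ?_
      simp only [RCLike.star_def, map_mul, inner_conj_symm]
      ring
    simp only [hl]
    rw [Finset.sum_congr rfl fun i _ => Finset.sum_comm, Finset.sum_comm]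
    refine Finset.sum_congr rfl fun s _ => ?_
    rw [Finset.sum_congr rfl fun i _ => Finset.sum_comm, Finset.sum_comm]
  rw [hsum]
  exact Finset.sum_nonneg fun r _ => hX _ (hrank r)

/-- The normal extension to `B(H)` of `choiMap`. -/
def choiMapTilde (X : H →L[ℂ] H) : (H →L[ℂ] H) →ₗ[ℂ] (H →L[ℂ] H) :=
  elementary
    (fun s : (d × d) × (d × d) => m.Lmul
      (⟪m.ketBra (f s.1.1) (f s.1.2), X (m.ketBra (f s.2.1) (f s.2.2))⟫ •
        rankOne (f s.1.1) (g s.1.2)))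
    (fun s => m.Lmul (rankOne (g s.2.2) (f s.2.1)))

theorem inner_choiMapTilde (X : H →L[ℂ] H) {x0 : H}
    (hg : ∀ p, adjoint (m.toOp x0) (g p) = f p) (y z : H) :
    ⟪y, choiMapTilde m f g X (rankOne x0 x0) z⟫ =
      ⟪∑ α : d × d, ⟪m.ketBra (f α.1) (f α.2), y⟫ • m.ketBra (f α.1) (f α.2),
        X (∑ α : d × d, ⟪m.ketBra (f α.1) (f α.2), z⟫ • m.ketBra (f α.1) (f α.2))⟫ := by
  have hsmul : ∀ (c : ℂ) (a : K →L[ℂ] K) (x : H), m.Lmul (c • a) x = c • m.Lmul a x :=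
    fun c a x => m.inj (by simp [m.Lmul_eq])
  have hinner : ∀ p q, ⟪x0, m.Lmul (rankOne (g q) (f p)) z⟫ = ⟪m.ketBra (f p) (f q), z⟫ := by
    intro p q
    rw [← m.inner_Lmul (a := rankOne (f p) (g q)) fun u v => (inner_rankOne _ _ _ _).symm,
      m.Lmul_rankOne, hg]
  simp only [choiMapTilde, elementary_apply, sum_apply, ContinuousLinearMap.comp_apply, hsmul,
    rankOne_apply, hinner, map_smul]
  simp only [m.Lmul_rankOne, hg, map_sum, map_smul, sum_inner, inner_sum, inner_smul_left,
    inner_smul_right, inner_conj_symm, Finset.mul_sum]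
  conv_rhs => rw [Finset.sum_comm]
  refine (Fintype.sum_prod_type _).trans ?_
  exact Finset.sum_congr rfl fun α _ => Finset.sum_congr rfl fun β _ => by ring

end Choi

theorem tendsto_pairing_of_compressions (b : HilbertBasis ι ℂ H) {G : Type*} {l : Filter G}
    (P : G → H →L[ℂ] H) (hP : ∀ i, ‖P i‖ ≤ 1) (hlim : ∀ x, Filter.Tendsto (P · x) l (nhds x))
    (X : H →L[ℂ] H) (Y : G → H →L[ℂ] H) (hY : ∀ i y z, ⟪y, Y i z⟫ = ⟪P i y, X (P i z)⟫)
    {T : H →L[ℂ] H} (hT : IsTraceClass T) :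
    Filter.Tendsto (fun i => pairing b (Y i) T) l (nhds (pairing b X T)) := by
  obtain ⟨x, y, h, hxy⟩ := hT
  simp only [pairing_of_nuclear b h hxy, hY]
  refine tendsto_tsum_of_dominated_convergence (h.mul_left ‖X‖)
    (fun n => (hlim _).inner ((X.continuous.tendsto _).comp (hlim _))) (.of_forall fun i n => ?_)
  have hle : ∀ v, ‖P i v‖ ≤ ‖v‖ := fun v => (P i).le_of_opNorm_le (hP i) v |>.trans_eq (one_mul _)
  calc ‖⟪P i (y n), X (P i (x n))⟫‖ ≤ ‖P i (y n)‖ * ‖X (P i (x n))‖ := norm_inner_le_norm _ _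
    _ ≤ ‖y n‖ * (‖X‖ * ‖x n‖) := by
        gcongr
        · exact hle _
        · exact (X.le_opNorm _).trans (by gcongr; exact hle _)
    _ = _ := by ring

/-- Lemma 5.2.  The set `C_{P^σ_k} = {C_φ : φ ∈ P^σ_k}` is
weak*-dense in the dual cone `A_k°` of the set `A_k` of all `ω_{x,x} ∈ T(H)`
with `rank x ≤ k`. -/
theorem statement12
    {K : Type*} [NormedAddCommGroup K] [InnerProductSpace ℂ K] [CompleteSpace K]
    [TopologicalSpace.SeparableSpace K]
    {ι : Type*} (e : HilbertBasis ι ℂ K)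
    {H : Type*} [NormedAddCommGroup H] [InnerProductSpace ℂ H] [CompleteSpace H]
    {ιH : Type*} (bH : HilbertBasis ιH ℂ H)
    (m : HSModel e H) (x0 : H) (hx0 : ‖x0‖ = 1)
    (hcyc : Dense {y : H | ∃ a : K →L[ℂ] K, m.Lmul a x0 = y})
    (hsep : ∀ a : K →L[ℂ] K, m.Lmul a x0 = 0 → m.Lmul a = 0)
    (k : ℕ) (X : H →L[ℂ] H)
    (hX : ∀ x : H, rankLE (m.toOp x) k → 0 ≤ pairing bH X (rankOne x x)) :
    ∀ (n : ℕ) (T : Fin n → (H →L[ℂ] H)), (∀ i, IsTraceClass (T i)) →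
      ∀ ε : ℝ, 0 < ε →
      ∃ (φ : (K →L[ℂ] K) →ₗ[ℂ] (K →L[ℂ] K)) (Φ Φst : (H →L[ℂ] H) →ₗ[ℂ] (H →L[ℂ] H)),
        kPos k φ ∧ NormalCB e φ ∧ HSExt m φ Φ ∧ IsNormalPair bH Φ Φst ∧
        ∀ i, ‖pairing bH X (T i) - pairing bH (Φ (rankOne x0 x0)) (T i)‖ < ε := by
  intro n T hT ε hε
  let U : Finset K → Submodule ℂ K := fun s =>
    Submodule.span ℂ (adjoint (m.toOp x0) '' (s : Set K))
  have hU : Monotone U := fun s t h => Submodule.span_mono (Set.image_mono h)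
  have : ∀ s, FiniteDimensional ℂ (U s) := fun s =>
    FiniteDimensional.span_of_finite ℂ (s.finite_toSet.image _)
  have : ∀ s, (m.corner (U s)).HasOrthogonalProjection := fun s =>
    m.hasOrthogonalProjection_corner (U s)
  have hdense : Dense {u | ∃ s, u ∈ U s} := by
    classical
    refine (HSModel.dense_range_adjoint fun v => m.toOp_injective_of_cyclic hcyc).mono ?_
    rintro _ ⟨v, rfl⟩
    exact ⟨{v}, Submodule.subset_span ⟨v, by simp, rfl⟩⟩
  have hlim : ∀ x, Filter.Tendsto (fun s => (m.corner (U s)).starProjection x) Filter.atTop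
      (nhds x) := fun x =>
    Submodule.starProjection_tendsto_self (fun s => m.corner (U s)) (m.corner_mono.comp hU) x
      (m.topologicalClosure_iSup_corner hU hdense)
  have hrange : ∀ s, ∀ u ∈ U s, ∃ v, adjoint (m.toOp x0) v = u := fun s u hu => by
    have hle : U s ≤ (adjoint (m.toOp x0)).range :=
      Submodule.span_le.2 (Set.image_subset_range _ _)
    exact hle hu
  let f := fun s => stdOrthonormalBasis ℂ (U s)
  choose g hg using fun s p => hrange s (f s p) (f s p).2
  have hconv : ∀ i, Filter.Tendsto
      (fun s => pairing bH (choiMapTilde m (fun p => (f s p : K)) (g s) X (rankOne x0 x0)) (T i))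
      Filter.atTop (nhds (pairing bH X (T i))) := fun i =>
    tendsto_pairing_of_compressions bH (fun s => (m.corner (U s)).starProjection)
      (fun s => Submodule.starProjection_norm_le _) hlim X _ (fun s y z => by
        rw [inner_choiMapTilde m _ _ X (hg s), ← m.compress_eq_starProjection (f s),
          ← m.compress_eq_starProjection (f s)]
        rfl) (hT i)
  obtain ⟨s, hs⟩ := (Filter.eventually_all.2 fun i =>
    Metric.tendsto_nhds.1 (hconv i) ε hε).exists
  have hpos : ∀ x : H, rankLE (m.toOp x) k → 0 ≤ ⟪x, X x⟫ := fun x hx => by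
    rw [← pairing_rankOne bH]
    exact hX x hx
  refine ⟨choiMap m (fun p => (f s p : K)) (g s) X, choiMapTilde m (fun p => (f s p : K)) (g s) X,
    _, kPos_choiMap m _ _ hpos, ⟨⟨_, isNormalPair_elementary e _ _⟩, isCBFullK_elementary _ _⟩,
    hsExt_elementary m _ _, isNormalPair_elementary bH _ _, fun i => ?_⟩
  rw [← dist_eq_norm, dist_comm]
  exact hs i
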